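/- Fix an integer d ≥ 5 and λ ∈ ℝ. Suppose Θ : ℝ → ℝ is a C² solution of the truncated equation with Θ(t) − e^t + (2d)^{-1}e^{3t} = O(e^{5t}) as t → −∞, and suppose that for each b > 0, Ψ_b : ℝ → ℝ is a C² solution of equation (E_λ) with Ψ_b(t) − b e^t + (λ b + b³)(2d)^{-1}e^{3t} = O(e^{5t}) as t → −∞. Then: (i) there exist constants b₀ > 0 and C₀ > 0 such that for every b > b₀ and every t ≤ 0, |Ψ_b(t − log b) − Θ(t)| ≤ C₀ b^{−2} e^{3t}; and (ii) for every T > 0 and every a ∈ (0,1) there exist constants b_{T,a} > 0 and C_{T,a} > 0 such that for every b > b_{T,a}, sup over t ∈ [0, T + a·log b] of |Ψ_b(t − log b) − Θ(t)| is at most C_{T,a} b^{−2(1−a)}. -/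

import Mathlib

open Filter Asymptotics Topology Set

/-- A function tending to zero at `-∞` has a sequence of points along which
its derivative tends to zero too. -/
lemma exists_seq (z z1 : ℝ → ℝ) (hz : ∀ t, HasDerivAt z (z1 t) t)
    (h0 : Tendsto z atBot (𝓝 0)) :
    ∃ ξ : ℕ → ℝ, Tendsto ξ atTop atBot ∧ Tendsto (fun n => z (ξ n)) atTop (𝓝 0) ∧
      Tendsto (fun n => z1 (ξ n)) atTop (𝓝 0) := by
  have h1 : ∀ n : ℕ, ∃ x ∈ Ioo (-(n:ℝ) - 1) (-(n:ℝ)), z1 x = z (-(n:ℝ)) - z (-(n:ℝ) - 1) := by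
    intro n
    obtain ⟨x, hx, hx'⟩ := exists_hasDerivAt_eq_slope z z1 (a := -(n:ℝ) - 1) (b := -(n:ℝ))
      (by linarith) (fun t _ => (hz t).continuousAt.continuousWithinAt) (fun t _ => hz t)
    refine ⟨x, hx, ?_⟩
    rw [hx']
    have : -(n:ℝ) - (-(n:ℝ) - 1) = 1 := by ring
    rw [this, div_one]
  choose ξ hξ hξ' using h1
  have hn : Tendsto (fun n : ℕ => -(n:ℝ)) atTop atBot :=
    tendsto_neg_atTop_atBot.comp tendsto_natCast_atTop_atTop
  have hn1 : Tendsto (fun n : ℕ => -(n:ℝ) - 1) atTop atBot :=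
    tendsto_atBot_mono (fun n => by linarith) hn
  have hξt : Tendsto ξ atTop atBot := tendsto_atBot_mono (fun n => (hξ n).2.le) hn
  refine ⟨ξ, hξt, h0.comp hξt, ?_⟩
  have := (h0.comp hn).sub (h0.comp hn1)
  simp only [sub_zero] at this
  exact this.congr (fun n => (hξ' n).symm)

lemma anti_bound (Y Y1 : ℝ → ℝ) (τ L : ℝ) (hY : ∀ t, HasDerivAt Y (Y1 t) t)
    (hneg : ∀ t ≤ τ, Y1 t ≤ 0) (ξ r : ℕ → ℝ) (hξ : Tendsto ξ atTop atBot)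
    (hle : ∀ᶠ n in atTop, Y (ξ n) ≤ r n) (hL : Tendsto r atTop (𝓝 L)) : Y τ ≤ L := by
  have hanti : AntitoneOn Y (Iic τ) := by
    apply antitoneOn_of_deriv_nonpos (convex_Iic τ)
    · exact fun t _ => (hY t).continuousAt.continuousWithinAt
    · exact fun t _ => (hY t).differentiableAt.differentiableWithinAt
    · intro t ht
      rw [interior_Iic] at ht
      rw [(hY t).deriv]
      exact hneg t (le_of_lt ht)
  apply ge_of_tendsto hL
  filter_upwards [hle, hξ.eventually_le_atBot τ] with n hn hn'
  exact (hanti hn' (mem_Iic.2 le_rfl) hn').trans hn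

lemma comparison (X X1 : ℝ → ℝ) (τ c : ℝ) (hc : 0 ≤ c) (hX : ∀ t, HasDerivAt X (X1 t) t)
    (hneg : ∀ t ≤ τ, X1 t ≤ -c * X t) (ξ : ℕ → ℝ) (hξ : Tendsto ξ atTop atBot)
    (hL : Tendsto (fun n => X (ξ n)) atTop (𝓝 0)) : X τ ≤ 0 := by
  have h := anti_bound (fun t => Real.exp (c * t) * X t)
    (fun t => (Real.exp (c * t) * (c * 1)) * X t + Real.exp (c * t) * X1 t) τ 0
    (fun t => (((hasDerivAt_id t).const_mul c).exp).mul (hX t))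
    (fun t ht => by
      have h1 := hneg t ht
      have h2 := Real.exp_pos (c * t)
      nlinarith)
    ξ (fun n => |X (ξ n)|) hξ
    (by
      filter_upwards [hξ.eventually_le_atBot 0] with n hn
      have h1 : Real.exp (c * ξ n) ≤ 1 := Real.exp_le_one_iff.2 (by nlinarith)
      have h2 := Real.exp_pos (c * ξ n)
      have h3 := le_abs_self (X (ξ n))
      have h4 := abs_nonneg (X (ξ n))
      nlinarith)
    (by simpa using hL.abs)
  have h2 := Real.exp_pos (c * τ)
  by_contra hcon
  push Not at hcon
  have := mul_pos h2 hcon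
  linarith

/-- the perturbation coefficient -/
noncomputable def pert (lam ε t : ℝ) : ℝ := -lam * ε * Real.exp (2 * t) + ε ^ 2 * Real.exp (4 * t)

lemma exp4 (t : ℝ) : Real.exp (4 * t) = Real.exp (2 * t) ^ 2 := by
  rw [← Real.exp_nat_mul]; congr 1; push_cast; ring

lemma exp8 (t : ℝ) : Real.exp (8 * t) = Real.exp (2 * t) ^ 4 := by
  rw [← Real.exp_nat_mul]; congr 1; push_cast; ring

lemma hasDerivAt_expc (c t : ℝ) :
    HasDerivAt (fun t => Real.exp (c * t)) (c * Real.exp (c * t)) t := by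
  have := ((hasDerivAt_id t).const_mul c).exp
  simp only [id, mul_one] at this
  rw [mul_comm]; exact this

set_option maxHeartbeats 1000000 in
/-- Uniform bound from the energy. -/
lemma energy_bound (k lam : ℝ) (hk : 1 ≤ k) (σ : ℝ) (hσ0 : 0 ≤ σ) (hσ1 : σ ≤ 1)
    (hσ : σ * ((lam ^ 2 + 1) * ((k + 3) ^ 2 / 2)) ≤ 1)
    (ε : ℝ) (hε : 0 ≤ ε) (u u1 u2 : ℝ → ℝ) (hu : ∀ t, HasDerivAt u (u1 t) t)
    (hu1 : ∀ t, HasDerivAt u1 (u2 t) t)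
    (heq : ∀ t, u2 t + k * u1 t - (k + 1) * u t + u t ^ 3 = pert lam ε t * u t)
    (h0 : Tendsto u atBot (𝓝 0)) (τ : ℝ) (hτ : ε * Real.exp (2 * τ) ≤ σ) :
    u τ ^ 2 ≤ 2 * k + 3 := by
  obtain ⟨ξ, hξ, hξ0, hξ1⟩ := exists_seq u u1 hu h0
  set N : ℝ := (k + 3) ^ 2 / 4 with hN
  set F : ℝ → ℝ := fun t => u1 t ^ 2 / 2 - (k + 1) * u t ^ 2 / 2 + u t ^ 4 / 4 + N with hF
  set Q : ℝ → ℝ := fun t => lam ^ 2 * ε ^ 2 * Real.exp (4 * t) / 8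
    + ε ^ 4 * Real.exp (8 * t) / 16 with hQ
  set Q1 : ℝ → ℝ := fun t => lam ^ 2 * ε ^ 2 * (4 * Real.exp (4 * t)) / 8
    + ε ^ 4 * (8 * Real.exp (8 * t)) / 16 with hQ1
  have hQd : ∀ t, HasDerivAt Q (Q1 t) t := fun t =>
    (((hasDerivAt_expc 4 t).const_mul _).div_const 8).add
      (((hasDerivAt_expc 8 t).const_mul _).div_const 16)
  set F1 : ℝ → ℝ := fun t => u1 t * u2 t - (k + 1) * u t * u1 t + u t ^ 3 * u1 t with hF1
  have hFd : ∀ t, HasDerivAt F (F1 t) t := by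
    intro t
    have := (((((hu1 t).pow 2).div_const 2).sub ((((hu t).pow 2).const_mul (k + 1)).div_const 2)).add
      (((hu t).pow 4).div_const 4)).add_const N
    refine HasDerivAt.congr_deriv (f := F) this ?_
    simp only [hF1]; push_cast; ring
  have hFu : ∀ t, u t ^ 2 ≤ F t := by
    intro t
    simp only [hF, hN]
    nlinarith [sq_nonneg (u1 t), sq_nonneg (u t ^ 2 - (k + 3))]
  have hF1le : ∀ t, F1 t ≤ Q1 t * F t := by
    intro t
    have e1 : F1 t = - k * u1 t ^ 2 + pert lam ε t * u t * u1 t := by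
      have := heq t
      have h2 : u2 t = pert lam ε t * u t - k * u1 t + (k + 1) * u t - u t ^ 3 := by linarith
      simp only [hF1, h2]; ring
    have e2 : F1 t ≤ pert lam ε t ^ 2 / 4 * u t ^ 2 := by
      rw [e1]
      nlinarith [sq_nonneg (u1 t - pert lam ε t * u t / 2), sq_nonneg (u1 t)]
    have e3 : pert lam ε t ^ 2 / 4 ≤ Q1 t := by
      simp only [hQ1, pert, exp4, exp8]
      nlinarith [sq_nonneg (lam * ε * Real.exp (2 * t) + ε ^ 2 * Real.exp (2 * t) ^ 2)]
    have e4 : 0 ≤ pert lam ε t ^ 2 / 4 := by positivity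
    calc F1 t ≤ pert lam ε t ^ 2 / 4 * u t ^ 2 := e2
      _ ≤ Q1 t * u t ^ 2 := by gcongr
      _ ≤ Q1 t * F t := mul_le_mul_of_nonneg_left (hFu t) (e4.trans e3)
  have hQ0 : ∀ t, 0 ≤ Q t := fun t => by simp only [hQ]; positivity
  have hmain := anti_bound (fun t => Real.exp (-Q t) * F t)
    (fun t => (Real.exp (-Q t) * (-Q1 t)) * F t + Real.exp (-Q t) * F1 t) τ N
    (fun t => ((hQd t).neg.exp).mul (hFd t))
    (fun t _ => by
      have h1 := hF1le t
      have h2 := Real.exp_pos (-Q t)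
      nlinarith)
    ξ (fun n => F (ξ n)) hξ
    (Eventually.of_forall fun n => by
      have h1 : Real.exp (-Q (ξ n)) ≤ 1 := Real.exp_le_one_iff.2 (by linarith [hQ0 (ξ n)])
      have h3 : 0 ≤ F (ξ n) := (sq_nonneg _).trans (hFu _)
      nlinarith)
    (by
      have := (((((hξ1.pow 2).div_const 2).sub (((hξ0.pow 2).const_mul (k + 1)).div_const 2)).add
        ((hξ0.pow 4).div_const 4)).add_const N)
      simpa [hF] using this)
  have hFle : F τ ≤ N * Real.exp (Q τ) := by
    have h2 := Real.exp_pos (Q τ)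
    have h3 : Real.exp (-Q τ) * Real.exp (Q τ) = 1 := by rw [← Real.exp_add]; simp
    calc F τ = (Real.exp (-Q τ) * F τ) * Real.exp (Q τ) := by linear_combination (-F τ) * h3
      _ ≤ _ := mul_le_mul_of_nonneg_right hmain h2.le
  have hx0 : 0 ≤ ε * Real.exp (2 * τ) := by positivity
  have hQle : Q τ ≤ σ * (σ * (lam ^ 2 + 1)) / 2 := by
    have a1 : (ε * Real.exp (2 * τ)) ^ 2 ≤ σ ^ 2 := by gcongr
    have a2 : (ε * Real.exp (2 * τ)) ^ 4 ≤ σ ^ 4 := by gcongr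
    have a3 : σ ^ 4 ≤ σ ^ 2 := pow_le_pow_of_le_one hσ0 hσ1 (by norm_num)
    have a4 : Q τ = lam ^ 2 * (ε * Real.exp (2 * τ)) ^ 2 / 8 + (ε * Real.exp (2 * τ)) ^ 4 / 16 := by
      simp only [hQ, exp4, exp8]; ring
    rw [a4]
    nlinarith [sq_nonneg lam, mul_le_mul_of_nonneg_left a1 (sq_nonneg lam), sq_nonneg σ,
      mul_nonneg (sq_nonneg lam) (sq_nonneg σ)]
  have hN4 : 4 ≤ N := by simp only [hN]; nlinarith
  have hs : σ * (lam ^ 2 + 1) * N ≤ 1 / 2 := by simp only [hN]; linarith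
  have hs0 : 0 ≤ σ * (lam ^ 2 + 1) := by positivity
  have hs1 : σ * (lam ^ 2 + 1) ≤ 1 := by nlinarith
  have hQ1' : Q τ ≤ 1 / 2 := by nlinarith
  have hQN : Q τ * N ≤ 1 / 4 := by nlinarith
  have hexp : Real.exp (Q τ) ≤ 1 + 2 * Q τ := by
    have h1 := Real.add_one_le_exp (-Q τ)
    have h2 := Real.exp_pos (Q τ)
    have h3 : Real.exp (-Q τ) * Real.exp (Q τ) = 1 := by rw [← Real.exp_add]; simp
    have h4 : (1 - Q τ) * Real.exp (Q τ) ≤ 1 := by nlinarith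
    have h5 : 1 ≤ (1 - Q τ) * (1 + 2 * Q τ) := by nlinarith [hQ0 τ]
    have h6 : 0 < 1 - Q τ := by linarith
    exact le_of_mul_le_mul_left (h4.trans h5) h6
  have hE : u τ ^ 4 / 4 - (k + 1) * u τ ^ 2 / 2 ≤ 1 := by
    have : F τ ≤ N + 2 * (Q τ * N) := by nlinarith
    simp only [hF] at this
    nlinarith [sq_nonneg (u1 τ)]
  by_contra hcon
  push Not at hcon
  nlinarith

lemma quad_form (δ W z p : ℝ) (hδ : 5 / 2 ≤ δ) (hW : 3 ≤ W) (hW' : W ≤ 4 * δ ^ 2 - 5) :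
    -δ * p ^ 2 - W * z * p - δ * W * z ^ 2 ≤
      -(1 / (2 * δ ^ 3)) * ((p + δ * z) ^ 2 / 2 + δ ^ 2 * z ^ 2 / 2) := by
  have hδ0 : 0 < δ := by linarith
  set c : ℝ := 1 / (2 * δ ^ 3) with hc
  have hc0 : 0 < c := by positivity
  have hcδ : c * δ ^ 3 = 1 / 2 := by rw [hc]; field_simp
  have hcs : c < δ := by
    have : 1 < δ ^ 3 := by
      have := pow_le_pow_left₀ (by norm_num) hδ 3
      linarith [show (5/2 : ℝ) ^ 3 = 125 / 8 by norm_num]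
    by_contra h
    push Not at h
    nlinarith
  have h1 : (p + δ * z) ^ 2 / 2 + δ ^ 2 * z ^ 2 / 2 ≤ p ^ 2 + 2 * δ ^ 2 * z ^ 2 := by
    nlinarith [sq_nonneg (p - δ * z), sq_nonneg (δ * z)]
  have h2 : 0 ≤ (δ - c) * p ^ 2 + W * z * p + (δ * W - 2 * c * δ ^ 2) * z ^ 2 := by
    have hd : 0 ≤ 4 * (δ - c) * (δ * W - 2 * c * δ ^ 2) - W ^ 2 := by
      have a1 : 15 ≤ W * (4 * δ ^ 2 - W) := by nlinarith
      have a2 : c * δ * W ≤ c * δ * (4 * δ ^ 2) :=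
        mul_le_mul_of_nonneg_left (by linarith) (by positivity)
      have a3 : 0 ≤ c ^ 2 * δ ^ 2 := by positivity
      nlinarith
    have hpos : 0 < δ - c := by linarith
    have : 0 ≤ 4 * (δ - c) * ((δ - c) * p ^ 2 + W * z * p + (δ * W - 2 * c * δ ^ 2) * z ^ 2) := by
      have e : 4 * (δ - c) * ((δ - c) * p ^ 2 + W * z * p + (δ * W - 2 * c * δ ^ 2) * z ^ 2)
        = (2 * (δ - c) * p + W * z) ^ 2 + (4 * (δ - c) * (δ * W - 2 * c * δ ^ 2) - W ^ 2) * z ^ 2 := by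
        ring
      rw [e]; positivity
    exact nonneg_of_mul_nonneg_right this (by positivity)
  nlinarith [mul_le_mul_of_nonneg_left h1 hc0.le]

/-- the barrier -/
noncomputable def barr (t : ℝ) : ℝ := 1 - 1 / (1 + Real.exp (2 * t))

lemma barr_eq (t : ℝ) : barr t = Real.exp (2 * t) / (1 + Real.exp (2 * t)) := by
  have := Real.exp_pos (2 * t)
  unfold barr; field_simp; ring

lemma barr_deriv (t : ℝ) :
    HasDerivAt barr (2 * Real.exp (2 * t) / (1 + Real.exp (2 * t)) ^ 2) t := by
  have h := Real.exp_pos (2 * t)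
  have := (((hasDerivAt_expc 2 t).const_add 1).inv (by positivity)).const_sub 1
  have e : barr = fun x => 1 - (1 + Real.exp (2 * x))⁻¹ := by funext s; simp [barr]
  rw [e]
  refine HasDerivAt.congr_deriv this ?_
  ring

lemma barr_nonneg (t : ℝ) : 0 ≤ barr t := by rw [barr_eq]; positivity
lemma barr_le_one (t : ℝ) : barr t ≤ 1 := by unfold barr; simp; positivity
lemma barr_le_exp (t : ℝ) : barr t ≤ Real.exp (2 * t) := by
  rw [barr_eq]
  have h := Real.exp_pos (2 * t)
  exact div_le_self h.le (by linarith)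

lemma exp2_tendsto : Tendsto (fun t : ℝ => Real.exp (2 * t)) atBot (𝓝 0) :=
  Real.tendsto_exp_atBot.comp (tendsto_id.const_mul_atBot (by norm_num))

lemma barr_tendsto : Tendsto barr atBot (𝓝 0) :=
  squeeze_zero barr_nonneg barr_le_exp exp2_tendsto

lemma tendsto_zero_of_decay (h : ℝ → ℝ)
    (hh : Tendsto (fun t => Real.exp (-2 * t) * (h t - Real.exp t)) atBot (𝓝 0)) :
    Tendsto h atBot (𝓝 0) := by
  have := (hh.mul exp2_tendsto).add Real.tendsto_exp_atBot
  simp only [mul_zero, add_zero] at this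
  refine this.congr fun t => ?_
  have e : Real.exp (-2 * t) * Real.exp (2 * t) = 1 := by rw [← Real.exp_add]; ring_nf; simp
  linear_combination (h t - Real.exp t) * e

lemma theta_bound (Θ : ℝ → ℝ) (M : ℝ) (hM : 0 ≤ M) (hb : ∀ t, Θ t ^ 2 ≤ M)
    (hh : Tendsto (fun t => Real.exp (-2 * t) * (Θ t - Real.exp t)) atBot (𝓝 0)) :
    ∃ C > 0, ∀ t, Θ t ^ 2 ≤ C * barr t := by
  have h1 : ∀ᶠ t in atBot, |Real.exp (-2 * t) * (Θ t - Real.exp t)| < 1 := by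
    have := hh.abs
    rw [abs_zero] at this
    exact this.eventually_lt_const (by norm_num)
  obtain ⟨t0, ht0⟩ := eventually_atBot.1 h1
  set t1 := min t0 0
  refine ⟨8 + M * (1 + Real.exp (-2 * t1)), by positivity, fun t => ?_⟩
  have hE := Real.exp_pos (2 * t)
  rcases le_total t t1 with ht | ht
  · have a := ht0 t (ht.trans (min_le_left _ _))
    have ht' : t ≤ 0 := ht.trans (min_le_right _ _)
    rw [abs_mul, abs_of_pos (Real.exp_pos _)] at a
    have e : Real.exp (-2 * t) * Real.exp (2 * t) = 1 := by rw [← Real.exp_add]; ring_nf; simp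
    have e2 : Real.exp (2 * t) = Real.exp t ^ 2 := by
      rw [← Real.exp_nat_mul]; congr 1
    have a2 : |Θ t - Real.exp t| ≤ Real.exp (2 * t) := by
      have := mul_lt_mul_of_pos_right a hE
      have e3 : Real.exp (-2 * t) * |Θ t - Real.exp t| * Real.exp (2 * t) = |Θ t - Real.exp t| := by
        linear_combination |Θ t - Real.exp t| * e
      linarith
    have hx := Real.exp_pos t
    have hx1 : Real.exp t ≤ 1 := Real.exp_le_one_iff.2 ht'
    have a3 : |Θ t| ≤ 2 * Real.exp t := by
      have h5 := abs_sub_abs_le_abs_sub (Θ t) (Real.exp t)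
      rw [abs_of_pos hx] at h5
      nlinarith
    have a4 : Θ t ^ 2 ≤ 4 * Real.exp (2 * t) := by
      rw [← sq_abs, e2]; nlinarith [abs_nonneg (Θ t)]
    have a5 : Real.exp (2 * t) ≤ 2 * barr t := by
      rw [barr_eq, mul_div_assoc', le_div_iff₀ (by positivity)]
      have : Real.exp (2 * t) ≤ 1 := Real.exp_le_one_iff.2 (by linarith)
      nlinarith
    have : 0 ≤ M * (1 + Real.exp (-2 * t1)) * barr t := by
      have := barr_nonneg t; positivity
    nlinarith
  · have a1 : 1 ≤ (1 + Real.exp (-2 * t1)) * barr t := by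
      rw [barr_eq, mul_div_assoc', le_div_iff₀ (by positivity)]
      have : 1 ≤ Real.exp (-2 * t1) * Real.exp (2 * t) := by
        rw [← Real.exp_add]; exact Real.one_le_exp (by linarith)
      nlinarith
    have := hb t
    have := barr_nonneg t
    nlinarith [mul_le_mul_of_nonneg_left a1 hM]

set_option maxHeartbeats 1000000 in
lemma main_lemma (k lam : ℝ) (hk : 1 ≤ k) (Θ Θ1 Θ2 : ℝ → ℝ)
    (hΘ : ∀ t, HasDerivAt Θ (Θ1 t) t) (hΘ1 : ∀ t, HasDerivAt Θ1 (Θ2 t) t)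
    (hΘeq : ∀ t, Θ2 t + k * Θ1 t - (k + 1) * Θ t + Θ t ^ 3 = 0)
    (hΘ0 : Tendsto (fun t => Real.exp (-2 * t) * (Θ t - Real.exp t)) atBot (𝓝 0)) :
    ∃ K > 0, ∃ σ > 0, ∀ ε > 0, ∀ v v1 v2 : ℝ → ℝ,
      (∀ t, HasDerivAt v (v1 t) t) → (∀ t, HasDerivAt v1 (v2 t) t) →
      (∀ t, v2 t + k * v1 t - (k + 1) * v t + v t ^ 3 = pert lam ε t * v t) →
      Tendsto (fun t => Real.exp (-2 * t) * (v t - Real.exp t)) atBot (𝓝 0) →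
      ∀ t, ε * Real.exp (2 * t) ≤ σ →
        |v t - Θ t| ≤ K * ε * Real.exp (3 * t) ∧ |v t - Θ t| ≤ K * ε * Real.exp (2 * t) := by
  set P : ℝ := (lam ^ 2 + 1) * ((k + 3) ^ 2 / 2) with hP
  have hP8 : 8 * (lam ^ 2 + 1) ≤ P := by
    rw [hP]; nlinarith [sq_nonneg lam, mul_nonneg (sq_nonneg lam) (show 0 ≤ (k+3)^2/2 - 8 by nlinarith)]
  have hP0 : 0 < P := by nlinarith [sq_nonneg lam]
  set σ : ℝ := 1 / P with hσdef
  have hσ0 : 0 < σ := by positivity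
  have hσP : σ * P = 1 := by rw [hσdef]; field_simp
  have hσ1 : σ ≤ 1 := by nlinarith [sq_nonneg lam]
  have hσl : σ * (|lam| + 1) ≤ 1 := by
    have : |lam| + 1 ≤ P := by nlinarith [sq_nonneg (|lam| - 1), sq_abs lam]
    nlinarith
  have hΘb : ∀ t, Θ t ^ 2 ≤ 2 * k + 3 := fun t =>
    energy_bound k lam hk σ hσ0.le hσ1 hσP.le 0 le_rfl Θ Θ1 Θ2 hΘ hΘ1
      (fun t => by rw [hΘeq t]; simp [pert]) (tendsto_zero_of_decay Θ hΘ0) t (by simpa using hσ0.le)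
  obtain ⟨C, hC, hΘC⟩ := theta_bound Θ (2 * k + 3) (by linarith) hΘb hΘ0
  set δ : ℝ := (k + 4) / 2 with hδ
  have hδ52 : 5 / 2 ≤ δ := by rw [hδ]; linarith
  set c : ℝ := 1 / (2 * δ ^ 3) with hc
  have hc0 : 0 < c := by positivity
  set G : ℝ := (|lam| + 1) ^ 2 * C / c with hG
  have hG0 : 0 < G := by positivity
  set A : ℝ := 2 * G / c with hA
  have hA0 : 0 < A := by positivity
  refine ⟨Real.sqrt (2 * A), by positivity, σ, hσ0, ?_⟩
  intro ε hε v v1 v2 hv hv1 hveq hv0 τ hτ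
  -- the rescaled difference
  set z : ℝ → ℝ := fun t => Real.exp (-2 * t) * (v t - Θ t) with hz
  set p : ℝ → ℝ := fun t => Real.exp (-2 * t) * (v1 t - Θ1 t - 2 * (v t - Θ t)) with hp
  set p1 : ℝ → ℝ := fun t => Real.exp (-2 * t) * (v2 t - Θ2 t - 4 * (v1 t - Θ1 t)
    + 4 * (v t - Θ t)) with hp1
  have hzd : ∀ t, HasDerivAt z (p t) t := by
    intro t
    refine HasDerivAt.congr_deriv (f := z)
      ((hasDerivAt_expc (-2) t).mul ((hv t).sub (hΘ t))) ?_
    simp only [hp, Pi.sub_apply]; ring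
  have hpd : ∀ t, HasDerivAt p (p1 t) t := by
    intro t
    refine HasDerivAt.congr_deriv (f := p) ((hasDerivAt_expc (-2) t).mul (((hv1 t).sub (hΘ1 t)).sub
      (((hv t).sub (hΘ t)).const_mul 2))) ?_
    simp only [hp1, Pi.sub_apply]; ring
  have hz0 : Tendsto z atBot (𝓝 0) := by
    have := hv0.sub hΘ0
    rw [sub_zero] at this
    refine this.congr fun t => ?_
    simp only [hz]; ring
  obtain ⟨ξ, hξ, hξ0, hξ1⟩ := exists_seq z p hzd hz0
  set W : ℝ → ℝ := fun t => k + 3 + (v t ^ 2 + v t * Θ t + Θ t ^ 2) - pert lam ε t with hW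
  set g : ℝ → ℝ := fun t => Real.exp (-2 * t) * pert lam ε t * Θ t with hg
  have hzeq : ∀ t, p1 t = -2 * δ * p t - W t * z t + g t := by
    intro t
    simp only [hp1, hp, hW, hz, hg, hδ]
    linear_combination Real.exp (-2 * t) * (hveq t - hΘeq t)
  set H : ℝ → ℝ := fun t => (p t + δ * z t) ^ 2 / 2 + δ ^ 2 * z t ^ 2 / 2 with hH
  set H1 : ℝ → ℝ := fun t => (p t + δ * z t) * (p1 t + δ * p t) + δ ^ 2 * z t * p t with hH1
  have hHd : ∀ t, HasDerivAt H (H1 t) t := by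
    intro t
    refine HasDerivAt.congr_deriv (f := H)
      (((((hpd t).add ((hzd t).const_mul δ)).pow 2).div_const 2).add
      ((((hzd t).pow 2).const_mul (δ ^ 2)).div_const 2)) ?_
    simp only [hH1, Pi.add_apply]; push_cast; ring
  set X : ℝ → ℝ := fun t => H t - ε ^ 2 * A * barr t with hX
  have key := comparison X (fun t => H1 t - ε ^ 2 * A *
      (2 * Real.exp (2 * t) / (1 + Real.exp (2 * t)) ^ 2)) τ (c / 2) (by positivity)
    (fun t => (hHd t).sub ((barr_deriv t).const_mul _))
    (by
      intro t ht
      have hE := Real.exp_pos (2 * t)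
      have hεt : ε * Real.exp (2 * t) ≤ σ := by
        refine le_trans ?_ hτ
        have : Real.exp (2 * t) ≤ Real.exp (2 * τ) := Real.exp_le_exp.2 (by linarith)
        gcongr
      have hεt0 : 0 ≤ ε * Real.exp (2 * t) := by positivity
      have hvb : v t ^ 2 ≤ 2 * k + 3 :=
        energy_bound k lam hk σ hσ0.le hσ1 hσP.le ε hε.le v v1 v2 hv hv1 hveq
          (tendsto_zero_of_decay v hv0) t hεt
      have hpe : pert lam ε t = (ε * Real.exp (2 * t)) * (-lam + ε * Real.exp (2 * t)) := by
        simp only [pert, exp4]; ring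
      have hab : |-lam + ε * Real.exp (2 * t)| ≤ |lam| + 1 := by
        refine (abs_add_le _ _).trans ?_
        rw [abs_neg, abs_of_nonneg hεt0]; linarith
      have hpb : |pert lam ε t| ≤ 1 := by
        rw [hpe, abs_mul, abs_of_nonneg hεt0]
        calc _ ≤ σ * (|lam| + 1) := by gcongr
          _ ≤ 1 := hσl
      obtain ⟨hpb1, hpb2⟩ := abs_le.1 hpb
      have hW3 : 3 ≤ W t := by
        simp only [hW]
        nlinarith [sq_nonneg (v t + Θ t), sq_nonneg (v t), sq_nonneg (Θ t)]
      have hW4 : W t ≤ 4 * δ ^ 2 - 5 := by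
        simp only [hW, hδ]
        nlinarith [sq_nonneg (v t - Θ t), hΘb t]
      have hq := quad_form δ (W t) (z t) (p t) hδ52 hW3 hW4
      have hgb : g t ^ 2 ≤ ε ^ 2 * ((|lam| + 1) ^ 2 * C) * barr t := by
        have e : Real.exp (-2 * t) * Real.exp (2 * t) = 1 := by rw [← Real.exp_add]; ring_nf; simp
        have e1 : g t = ε * (-lam + ε * Real.exp (2 * t)) * Θ t := by
          simp only [hg, hpe]
          linear_combination (ε * (-lam + ε * Real.exp (2 * t)) * Θ t) * e
        have e2 : (-lam + ε * Real.exp (2 * t)) ^ 2 ≤ (|lam| + 1) ^ 2 := by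
          rw [← sq_abs]; gcongr
        calc g t ^ 2 = ε ^ 2 * ((-lam + ε * Real.exp (2 * t)) ^ 2 * Θ t ^ 2) := by rw [e1]; ring
          _ ≤ ε ^ 2 * ((|lam| + 1) ^ 2 * (C * barr t)) := by
              have := hΘC t
              gcongr
          _ = _ := by ring
      have hH1e : H1 t = (-δ * p t ^ 2 - W t * z t * p t - δ * W t * z t ^ 2)
          + g t * (p t + δ * z t) := by
        simp only [hH1, hzeq t]; ring
      have hyoung : g t * (p t + δ * z t) ≤ c * (p t + δ * z t) ^ 2 / 4 + g t ^ 2 / c := by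
        have : c * (p t + δ * z t) ^ 2 / 4 + g t ^ 2 / c - g t * (p t + δ * z t)
          = (c * (p t + δ * z t) / 2 - g t) ^ 2 / c := by field_simp; ring
        have h2 : 0 ≤ (c * (p t + δ * z t) / 2 - g t) ^ 2 / c := by positivity
        linarith
      have hgc : g t ^ 2 / c ≤ ε ^ 2 * G * barr t := by
        rw [div_le_iff₀ hc0]
        refine hgb.trans (le_of_eq ?_)
        rw [hG]; field_simp
      have hxH : c * (p t + δ * z t) ^ 2 / 4 ≤ c / 2 * H t := by
        simp only [hH]
        have : 0 ≤ c * (δ ^ 2 * z t ^ 2) := by positivity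
        nlinarith
      have hAc : c / 2 * (ε ^ 2 * A * barr t) = ε ^ 2 * G * barr t := by
        rw [hA]; field_simp
      have hb1 : 0 ≤ ε ^ 2 * A * (2 * Real.exp (2 * t) / (1 + Real.exp (2 * t)) ^ 2) := by
        positivity
      have hq' : -δ * p t ^ 2 - W t * z t * p t - δ * W t * z t ^ 2 ≤ -c * H t := hq
      have hXt : X t = H t - ε ^ 2 * A * barr t := rfl
      rw [hXt]
      linarith)
    ξ hξ
    (by
      have h1 := ((((hξ1.add (hξ0.const_mul δ)).pow 2).div_const 2).add
        (((hξ0.pow 2).const_mul (δ ^ 2)).div_const 2)).sub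
        ((barr_tendsto.comp hξ).const_mul (ε ^ 2 * A))
      simpa [hX, hH] using h1)
  have hzb : z τ ^ 2 ≤ 2 * A * ε ^ 2 * barr τ := by
    simp only [hX, hH] at key
    nlinarith [sq_nonneg (p τ + δ * z τ), sq_nonneg (z τ), mul_nonneg (sq_nonneg (z τ)) (show 0 ≤ δ ^ 2 - 1 by nlinarith)]
  have hE := Real.exp_pos (2 * τ)
  have e : Real.exp (-2 * τ) * Real.exp (2 * τ) = 1 := by rw [← Real.exp_add]; ring_nf; simp
  have hwz : v τ - Θ τ = Real.exp (2 * τ) * z τ := by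
    simp only [hz]; linear_combination (-(v τ - Θ τ)) * e
  have hs2 : Real.sqrt (2 * A) ^ 2 = 2 * A := Real.sq_sqrt (by positivity)
  have e3 : Real.exp (3 * τ) = Real.exp (2 * τ) * Real.exp τ := by
    rw [← Real.exp_add]; ring_nf
  have e2 : Real.exp (2 * τ) = Real.exp τ ^ 2 := by
    rw [← Real.exp_nat_mul]; congr 1
  have hAe : 0 ≤ 2 * A * ε ^ 2 := by positivity
  have hz1 : |z τ| ≤ Real.sqrt (2 * A) * ε * Real.exp τ := by
    apply abs_le_of_sq_le_sq _ (by positivity)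
    have e4 : (Real.sqrt (2 * A) * ε * Real.exp τ) ^ 2 = 2 * A * ε ^ 2 * Real.exp (2 * τ) := by
      rw [e2, mul_pow, mul_pow, hs2]
    rw [e4]
    exact hzb.trans (mul_le_mul_of_nonneg_left (barr_le_exp τ) hAe)
  have hz2 : |z τ| ≤ Real.sqrt (2 * A) * ε := by
    apply abs_le_of_sq_le_sq _ (by positivity)
    have e4 : (Real.sqrt (2 * A) * ε) ^ 2 = 2 * A * ε ^ 2 := by rw [mul_pow, hs2]
    rw [e4]
    exact hzb.trans (mul_le_of_le_one_right hAe (barr_le_one τ))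
  rw [hwz, abs_mul, abs_of_pos hE]
  constructor
  · rw [e3]; nlinarith
  · nlinarith

lemma decay_of_asym (h : ℝ → ℝ) (β γ : ℝ)
    (hh : (fun t : ℝ => h t - β * Real.exp t + γ * Real.exp (3 * t))
      =O[atBot] fun t : ℝ => Real.exp (5 * t)) :
    Tendsto (fun t => Real.exp (-2 * t) * (h t - β * Real.exp t)) atBot (𝓝 0) := by
  have h1 := (isBigO_refl (fun t : ℝ => Real.exp (-2 * t)) atBot).mul hh
  have h3 : Tendsto (fun t : ℝ => Real.exp (-2 * t) * Real.exp (5 * t)) atBot (𝓝 0) := by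
    have : Tendsto (fun t : ℝ => Real.exp (3 * t)) atBot (𝓝 0) :=
      Real.tendsto_exp_atBot.comp (tendsto_id.const_mul_atBot (by norm_num))
    refine this.congr fun t => ?_
    rw [← Real.exp_add]; ring_nf
  have h4 := (h1.trans_tendsto h3).sub (Real.tendsto_exp_atBot.const_mul γ)
  simp only [mul_zero, sub_zero] at h4
  refine h4.congr fun t => ?_
  have e : Real.exp (-2 * t) * Real.exp (3 * t) = Real.exp t := by rw [← Real.exp_add]; ring_nf
  linear_combination γ * e

/-- Proposition 2.1 (Proposition `prop-b-solution` in the paper): closeness of the solution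
family `Ψ_b` (after translation by `log b`) to the heteroclinic orbit `Θ` of the truncated
equation, on `(-∞,0]` and on `[0, T + a log b]`. -/
theorem stmt_0 (d : ℤ) (hd : 5 ≤ d) (lam : ℝ)
    (Θ : ℝ → ℝ) (Ψ : ℝ → ℝ → ℝ)
    (hΘC : ContDiff ℝ 2 Θ)
    (hΘeq : ∀ t : ℝ, deriv (deriv Θ) t + ((d : ℝ) - 4) * deriv Θ t
      + (3 - (d : ℝ)) * Θ t + (Θ t) ^ 3 = 0)
    (hΘasym : (fun t : ℝ => Θ t - Real.exp t + (2 * (d : ℝ))⁻¹ * Real.exp (3 * t))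
      =O[atBot] fun t : ℝ => Real.exp (5 * t))
    (hΨC : ∀ b : ℝ, 0 < b → ContDiff ℝ 2 (Ψ b))
    (hΨeq : ∀ b : ℝ, 0 < b → ∀ t : ℝ,
      deriv (deriv (Ψ b)) t + ((d : ℝ) - 4) * deriv (Ψ b) t
        + (3 - (d : ℝ)) * Ψ b t + (Ψ b t) ^ 3
        = -lam * Real.exp (2 * t) * Ψ b t + Real.exp (4 * t) * Ψ b t)
    (hΨasym : ∀ b : ℝ, 0 < b →
      (fun t : ℝ => Ψ b t - b * Real.exp t
          + (lam * b + b ^ 3) * (2 * (d : ℝ))⁻¹ * Real.exp (3 * t))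
        =O[atBot] fun t : ℝ => Real.exp (5 * t)) :
    (∃ b₀ > (0 : ℝ), ∃ C₀ > (0 : ℝ), ∀ b > b₀, ∀ t ≤ (0 : ℝ),
      |Ψ b (t - Real.log b) - Θ t| ≤ C₀ * b ^ (-2 : ℝ) * Real.exp (3 * t)) ∧
    (∀ T > (0 : ℝ), ∀ a ∈ Set.Ioo (0 : ℝ) 1, ∃ bTa > (0 : ℝ), ∃ CTa > (0 : ℝ),
      ∀ b > bTa, ∀ t ∈ Set.Icc (0 : ℝ) (T + a * Real.log b),
        |Ψ b (t - Real.log b) - Θ t| ≤ CTa * b ^ (-2 * (1 - a))) := by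
  have hder : ∀ f : ℝ → ℝ, ContDiff ℝ 2 f →
      (∀ t, HasDerivAt f (deriv f t) t) ∧ (∀ t, HasDerivAt (deriv f) (deriv (deriv f) t) t) := by
    intro f hf
    have h2 : ContDiff ℝ 1 (deriv f) := by
      have : ContDiff ℝ (1 + 1) f := by
        rw [one_add_one_eq_two]; exact hf
      exact (contDiff_succ_iff_deriv.1 this).2.2
    exact ⟨fun t => (hf.differentiable (by norm_num) t).hasDerivAt,
      fun t => (h2.differentiable (by norm_num) t).hasDerivAt⟩
  have hk : (1 : ℝ) ≤ (d : ℝ) - 4 := by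
    have : (5 : ℝ) ≤ (d : ℝ) := by exact_mod_cast hd
    linarith
  have hΘ0 : Tendsto (fun t => Real.exp (-2 * t) * (Θ t - Real.exp t)) atBot (𝓝 0) := by
    have := decay_of_asym Θ 1 (2 * (d : ℝ))⁻¹ (by simpa using hΘasym)
    simpa using this
  obtain ⟨K, hK, σ, hσ, hmain⟩ := main_lemma ((d : ℝ) - 4) lam hk Θ (deriv Θ) (deriv (deriv Θ))
    (hder Θ hΘC).1 (hder Θ hΘC).2 (fun t => by rw [← hΘeq t]; ring) hΘ0
  have hall : ∀ b : ℝ, 0 < b → ∀ t, b ^ (-2 : ℝ) * Real.exp (2 * t) ≤ σ →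
      |Ψ b (t - Real.log b) - Θ t| ≤ K * b ^ (-2 : ℝ) * Real.exp (3 * t) ∧
      |Ψ b (t - Real.log b) - Θ t| ≤ K * b ^ (-2 : ℝ) * Real.exp (2 * t) := by
    intro b hb
    have hbr : b ^ (-2 : ℝ) = Real.exp (-2 * Real.log b) := by
      rw [Real.rpow_def_of_pos hb, mul_comm]
    have hbe : Real.exp (-Real.log b) = b⁻¹ := by rw [Real.exp_neg, Real.exp_log hb]
    obtain ⟨hd1, hd2⟩ := hder (Ψ b) (hΨC b hb)
    refine hmain (b ^ (-2 : ℝ)) (by positivity) (fun t => Ψ b (t - Real.log b))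
      (fun t => deriv (Ψ b) (t - Real.log b)) (fun t => deriv (deriv (Ψ b)) (t - Real.log b))
      (fun t => (hd1 _).comp_sub_const t (Real.log b))
      (fun t => (hd2 _).comp_sub_const t (Real.log b)) ?_ ?_
    · intro t
      have h := hΨeq b hb (t - Real.log b)
      have e1 : Real.exp (2 * (t - Real.log b)) = b ^ (-2 : ℝ) * Real.exp (2 * t) := by
        rw [hbr, ← Real.exp_add]; ring_nf
      have e2 : Real.exp (4 * (t - Real.log b)) = (b ^ (-2 : ℝ)) ^ 2 * Real.exp (4 * t) := by
        rw [hbr, ← Real.exp_nat_mul, ← Real.exp_add]; congr 1; push_cast; ring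
      rw [e1, e2] at h
      simp only [pert]
      linear_combination h
    · have h := decay_of_asym (Ψ b) b _ (hΨasym b hb)
      have hs : Tendsto (fun t : ℝ => t - Real.log b) atBot atBot :=
        tendsto_atBot_add_const_right _ _ tendsto_id
      have h2 := (h.comp hs).const_mul (b ^ (-2 : ℝ))
      rw [mul_zero] at h2
      refine h2.congr fun t => ?_
      have e1 : b ^ (-2 : ℝ) * Real.exp (-2 * (t - Real.log b)) = Real.exp (-2 * t) := by
        rw [hbr, ← Real.exp_add]; ring_nf
      have e2 : b * Real.exp (t - Real.log b) = Real.exp t := by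
        rw [sub_eq_add_neg, Real.exp_add, hbe]; field_simp
      simp only [Function.comp]
      rw [e2, ← mul_assoc, e1]
  constructor
  · have h0 : ∀ᶠ b : ℝ in atTop, b ^ (-2 : ℝ) < σ :=
      (tendsto_rpow_neg_atTop (by norm_num : (0:ℝ) < 2)).eventually_lt_const hσ
    obtain ⟨b0, hb0⟩ := eventually_atTop.1 h0
    refine ⟨max b0 1, by positivity, K, hK, fun b hb t ht => ?_⟩
    have hb1 : 0 < b := lt_trans (by positivity) hb
    refine (hall b hb1 t ?_).1
    have h1 := hb0 b ((le_max_left _ _).trans hb.le)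
    have h2 : Real.exp (2 * t) ≤ 1 := Real.exp_le_one_iff.2 (by linarith)
    have h3 : 0 < b ^ (-2 : ℝ) := by positivity
    nlinarith
  · intro T hT a ha
    have h0 : ∀ᶠ b : ℝ in atTop, Real.exp (2 * T) * b ^ (-(2 * (1 - a))) < σ := by
      have := (tendsto_rpow_neg_atTop (show (0:ℝ) < 2 * (1 - a) by linarith [ha.2])).const_mul
        (Real.exp (2 * T))
      rw [mul_zero] at this
      exact this.eventually_lt_const hσ
    obtain ⟨b0, hb0⟩ := eventually_atTop.1 h0
    refine ⟨max b0 1, by positivity, K * Real.exp (2 * T), by positivity, fun b hb t ht => ?_⟩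
    have hb1 : 0 < b := lt_trans (by positivity) hb
    have h1 := hb0 b ((le_max_left _ _).trans hb.le)
    have hx : b ^ (-2 : ℝ) * Real.exp (2 * t) ≤ Real.exp (2 * T) * b ^ (-2 * (1 - a)) := by
      rw [Real.rpow_def_of_pos hb1, Real.rpow_def_of_pos hb1, ← Real.exp_add, ← Real.exp_add]
      apply Real.exp_le_exp.2
      have := ht.2
      nlinarith
    have h2 : Real.exp (2 * T) * b ^ (-2 * (1 - a)) < σ := by
      rw [show -2 * (1 - a) = -(2 * (1 - a)) by ring]; exact h1
    have h3 := (hall b hb1 t (hx.trans h2.le)).2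
    refine h3.trans ?_
    rw [mul_assoc, mul_assoc]
    exact mul_le_mul_of_nonneg_left hx hK.le
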